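/- Fix a finite state space X and a rate matrix W (W_{ji} ≥ 0 for j ≠ i and Σ_j W_{ji} = 0 for each i, so that exp(tW) is a stochastic matrix for all t ≥ 0). Let Ġ be a linear functional on ℝ^X and define the classical EP rate Σ̇(p) as the right derivative at t = 0 of t ↦ H(exp(tW)p) plus Ġ(p), which exists and is finite whenever supp(Wp) ⊆ supp p. Suppose r is a probability distribution with supp(Wr) ⊆ supp r and Σ̇(r) ≤ Σ̇(q) for every probability distribution q with supp(Wq) ⊆ supp q. Then for every probability distribution p with supp p ⊆ supp r and supp(Wp) ⊆ supp p, one has Σ̇(p) − Σ̇(r) = −(d/dt)|_{t=0⁺} D(exp(tW)p ‖ exp(tW)r), where the KL divergence is finite for all small t ≥ 0 since supp(exp(tW)p) ⊆ supp(exp(tW)r). -/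

import Mathlib

open Finset

variable {X : Type*}

/-- A probability distribution on the finite state space `X`. -/
def IsProb [Fintype X] (p : X → ℝ) : Prop :=
  (∀ i, 0 ≤ p i) ∧ ∑ i, p i = 1

/-- A (column-)stochastic matrix: `T j i = T(j|i) ≥ 0` and `∑_j T(j|i) = 1`. -/
def IsStoch [Fintype X] (T : X → X → ℝ) : Prop :=
  (∀ i j, 0 ≤ T j i) ∧ ∀ i, ∑ j, T j i = 1

/-- The action of a stochastic matrix: `(Tp)_j = ∑_i T(j|i) p_i`. -/
def stApply [Fintype X] (T : X → X → ℝ) (p : X → ℝ) : X → ℝ :=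
  fun j => ∑ i, T j i * p i

/-- Shannon entropy `H(p) = −∑ p_i ln p_i`, with the convention `0 ln 0 = 0`. -/
noncomputable def shEnt [Fintype X] (p : X → ℝ) : ℝ :=
  -∑ i, p i * Real.log (p i)

/-- Kullback–Leibler divergence `D(p‖r) = ∑_{i : p_i > 0} p_i ln (p_i / r_i)`. -/
noncomputable def KL [Fintype X] (p r : X → ℝ) : ℝ :=
  ∑ i, p i * Real.log (p i / r i)

/-- The classical EP-type function `Σ(p) = H(Tp) − H(p) + G(p)`. -/
noncomputable def clEP [Fintype X] (T : X → X → ℝ) (G : (X → ℝ) →ₗ[ℝ] ℝ) (p : X → ℝ) : ℝ :=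
  shEnt (stApply T p) - shEnt p + G p

/-- The classical EP rate `Σ̇(p)`: right derivative at `t = 0` of `t ↦ H(exp(tW)p)` plus `Ġ(p)`. -/
noncomputable def clEPrate [Fintype X] [DecidableEq X] (W : Matrix X X ℝ)
    (G : (X → ℝ) →ₗ[ℝ] ℝ) (p : X → ℝ) : ℝ :=
  derivWithin (fun t : ℝ => shEnt ((NormedSpace.exp (t • W)).mulVec p)) (Set.Ici 0) 0 + G p

lemma aux_exp_zero [Fintype X] [DecidableEq X] (A : Matrix X X ℝ) (p : X → ℝ) (i : X)
    (h : ∀ n : ℕ, ((A ^ n).mulVec p) i = 0) : (NormedSpace.exp A).mulVec p i = 0 := by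
  let _ : NormedRing (Matrix X X ℝ) := Matrix.linftyOpNormedRing
  let _ : NormedAlgebra ℝ (Matrix X X ℝ) := Matrix.linftyOpNormedAlgebra
  have h1 := NormedSpace.exp_series_hasSum_exp' (𝕂 := ℝ) A
  let L : Matrix X X ℝ →ₗ[ℝ] ℝ :=
    { toFun := fun M => M.mulVec p i
      map_add' := fun M N => by simp [Matrix.add_mulVec]
      map_smul' := fun c M => by simp [Matrix.smul_mulVec] }
  have hL : Continuous L := L.continuous_of_finiteDimensional
  have h2 := h1.map L hL
  have h3 : (L ∘ fun n : ℕ => ((n.factorial : ℝ)⁻¹ • A ^ n)) = fun _ => (0:ℝ) := by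
    funext n
    simp only [Function.comp, map_smul]
    have : L (A ^ n) = 0 := h n
    rw [this, smul_zero]
  rw [h3] at h2
  exact h2.unique hasSum_zero

lemma aux_exp_deriv [Fintype X] [DecidableEq X] (W : Matrix X X ℝ) (p : X → ℝ) (i : X) :
    HasDerivAt (fun t : ℝ => (NormedSpace.exp (t • W)).mulVec p i) (W.mulVec p i) 0 := by
  let _ : NormedRing (Matrix X X ℝ) := Matrix.linftyOpNormedRing
  let _ : NormedAlgebra ℝ (Matrix X X ℝ) := Matrix.linftyOpNormedAlgebra
  have h1 := hasDerivAt_exp_smul_const (𝕂 := ℝ) W (0:ℝ)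
  let L : Matrix X X ℝ →ₗ[ℝ] ℝ :=
    { toFun := fun M => M.mulVec p i
      map_add' := fun M N => by simp [Matrix.add_mulVec]
      map_smul' := fun c M => by simp [Matrix.smul_mulVec] }
  let L' : Matrix X X ℝ →L[ℝ] ℝ := ⟨L, L.continuous_of_finiteDimensional⟩
  have h2 := L'.hasFDerivAt.comp_hasDerivAt (0:ℝ) h1
  rw [zero_smul, NormedSpace.exp_zero, one_mul] at h2
  exact h2

lemma aux_block [Fintype X] (W : Matrix X X ℝ)
    (hWoff : ∀ i j : X, j ≠ i → 0 ≤ W j i) (p : X → ℝ) (hp : ∀ i, 0 ≤ p i)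
    (hWp : ∀ i, (W.mulVec p) i ≠ 0 → 0 < p i) (i j : X) (hi : p i = 0) (hj : p j ≠ 0) :
    W i j = 0 := by
  have h0 : (W.mulVec p) i = 0 := by
    by_contra h
    exact (hWp i h).ne' hi
  have h1 : ∑ k, W i k * p k = 0 := h0
  rw [Finset.sum_eq_zero_iff_of_nonneg] at h1
  · have := h1 j (Finset.mem_univ j)
    exact (mul_eq_zero.mp this).resolve_right hj
  · intro k _
    by_cases hk : i = k
    · subst hk; simp [hi]
    · exact mul_nonneg (hWoff k i hk) (hp k)

lemma aux_pres [Fintype X] (W : Matrix X X ℝ)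
    (hWoff : ∀ i j : X, j ≠ i → 0 ≤ W j i) (p : X → ℝ) (hp : ∀ i, 0 ≤ p i)
    (hWp : ∀ i, (W.mulVec p) i ≠ 0 → 0 < p i) (q : X → ℝ) (hq : ∀ i, p i = 0 → q i = 0)
    (i : X) (hi : p i = 0) : W.mulVec q i = 0 := by
  show ∑ k, W i k * q k = 0
  apply Finset.sum_eq_zero
  intro k _
  by_cases hk : p k = 0
  · rw [hq k hk, mul_zero]
  · rw [aux_block W hWoff p hp hWp i k hi hk, zero_mul]

lemma aux_inv [Fintype X] [DecidableEq X] (W : Matrix X X ℝ)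
    (hWoff : ∀ i j : X, j ≠ i → 0 ≤ W j i) (p : X → ℝ) (hp : ∀ i, 0 ≤ p i)
    (hWp : ∀ i, (W.mulVec p) i ≠ 0 → 0 < p i) (t : ℝ) (i : X) (hi : p i = 0) :
    (NormedSpace.exp (t • W)).mulVec p i = 0 := by
  apply aux_exp_zero
  intro n
  have key : ∀ n : ℕ, ∀ i, p i = 0 → ((W ^ n).mulVec p) i = 0 := by
    intro n
    induction n with
    | zero => intro i hi; simpa using hi
    | succ n ih =>
      intro i hi
      rw [pow_succ', ← Matrix.mulVec_mulVec]
      exact aux_pres W hWoff p hp hWp _ ih i hi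
  rw [smul_pow, Matrix.smul_mulVec, Pi.smul_apply, key n i hi, smul_zero]

lemma aux_colsum [Fintype X] (W : Matrix X X ℝ) (hWcol : ∀ i : X, ∑ j, W j i = 0)
    (q : X → ℝ) : ∑ i, W.mulVec q i = 0 := by
  show ∑ i, ∑ k, W i k * q k = 0
  rw [Finset.sum_comm]
  apply Finset.sum_eq_zero
  intro k _
  rw [← Finset.sum_mul, hWcol, zero_mul]

lemma aux_at_zero [Fintype X] [DecidableEq X] (W : Matrix X X ℝ) (p : X → ℝ) :
    (NormedSpace.exp ((0:ℝ) • W)).mulVec p = p := by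
  rw [zero_smul, NormedSpace.exp_zero, Matrix.one_mulVec]

lemma aux_ent [Fintype X] [DecidableEq X] (W : Matrix X X ℝ)
    (hWoff : ∀ i j : X, j ≠ i → 0 ≤ W j i) (hWcol : ∀ i : X, ∑ j, W j i = 0)
    (p : X → ℝ) (hp : ∀ i, 0 ≤ p i)
    (hWp : ∀ i, (W.mulVec p) i ≠ 0 → 0 < p i) :
    HasDerivAt (fun t : ℝ => shEnt ((NormedSpace.exp (t • W)).mulVec p))
      (-∑ i, W.mulVec p i * Real.log (p i)) 0 := by
  have h : ∀ i ∈ (Finset.univ : Finset X), HasDerivAt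
      (fun t : ℝ => (NormedSpace.exp (t • W)).mulVec p i *
        Real.log ((NormedSpace.exp (t • W)).mulVec p i))
      (W.mulVec p i * Real.log (p i) + W.mulVec p i) 0 := by
    intro i _
    by_cases hi : p i = 0
    · have h0 := aux_pres W hWoff p hp hWp p (fun _ h => h) i hi
      simp only [aux_inv W hWoff p hp hWp _ i hi, h0]
      simpa using hasDerivAt_const (0:ℝ) (0:ℝ)
    · have h1 := aux_exp_deriv W p i
      have h2 := h1.mul (h1.log (by rw [aux_at_zero]; exact hi))
      simp only [aux_at_zero] at h2
      rw [mul_div_cancel₀ _ hi] at h2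
      exact h2
  have h3 := (HasDerivAt.fun_sum h).neg
  rw [Finset.sum_add_distrib, aux_colsum W hWcol, add_zero] at h3
  exact h3

lemma aux_rate [Fintype X] [DecidableEq X] (W : Matrix X X ℝ)
    (hWoff : ∀ i j : X, j ≠ i → 0 ≤ W j i) (hWcol : ∀ i : X, ∑ j, W j i = 0)
    (G : (X → ℝ) →ₗ[ℝ] ℝ) (p : X → ℝ) (hp : ∀ i, 0 ≤ p i)
    (hWp : ∀ i, (W.mulVec p) i ≠ 0 → 0 < p i) :
    clEPrate W G p = -∑ i, W.mulVec p i * Real.log (p i) + G p := by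
  unfold clEPrate
  rw [(aux_ent W hWoff hWcol p hp hWp).hasDerivWithinAt.derivWithin
    (uniqueDiffOn_Ici (0:ℝ) 0 Set.self_mem_Ici)]

lemma aux_KL [Fintype X] [DecidableEq X] (W : Matrix X X ℝ)
    (hWoff : ∀ i j : X, j ≠ i → 0 ≤ W j i) (hWcol : ∀ i : X, ∑ j, W j i = 0)
    (p r : X → ℝ) (hp : ∀ i, 0 ≤ p i)
    (hWp : ∀ i, (W.mulVec p) i ≠ 0 → 0 < p i) (hsupp : ∀ i, 0 < p i → 0 < r i) :
    HasDerivAt (fun t : ℝ => KL ((NormedSpace.exp (t • W)).mulVec p)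
        ((NormedSpace.exp (t • W)).mulVec r))
      (∑ i, (W.mulVec p i * Real.log (p i) - W.mulVec p i * Real.log (r i)
        - p i * (W.mulVec r i / r i))) 0 := by
  have h : ∀ i ∈ (Finset.univ : Finset X), HasDerivAt
      (fun t : ℝ => (NormedSpace.exp (t • W)).mulVec p i *
        Real.log ((NormedSpace.exp (t • W)).mulVec p i / (NormedSpace.exp (t • W)).mulVec r i))
      ((W.mulVec p i * Real.log (p i) - W.mulVec p i * Real.log (r i)
        - p i * (W.mulVec r i / r i)) + W.mulVec p i) 0 := by
    intro i _
    by_cases hi : p i = 0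
    · have h0 := aux_pres W hWoff p hp hWp p (fun _ h => h) i hi
      simp only [aux_inv W hWoff p hp hWp _ i hi, h0, hi]
      simpa using hasDerivAt_const (0:ℝ) (0:ℝ)
    · have hri : r i ≠ 0 := (hsupp i (lt_of_le_of_ne (hp i) (Ne.symm hi))).ne'
      have h1 := aux_exp_deriv W p i
      have h1r := aux_exp_deriv W r i
      have hd := h1.fun_div h1r (by rw [aux_at_zero]; exact hri)
      have h2 := h1.mul (hd.log (by
        simp only [aux_at_zero]; exact div_ne_zero hi hri))
      simp only [aux_at_zero] at h2
      refine h2.congr_deriv ?_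
      rw [Real.log_div hi hri]
      field_simp
      ring
  have h3 := HasDerivAt.fun_sum h
  rw [Finset.sum_add_distrib, aux_colsum W hWcol, add_zero] at h3
  exact h3

lemma aux_stat [Fintype X] [DecidableEq X]
    (W : Matrix X X ℝ)
    (hWoff : ∀ i j : X, j ≠ i → 0 ≤ W j i)
    (hWcol : ∀ i : X, ∑ j, W j i = 0)
    (G : (X → ℝ) →ₗ[ℝ] ℝ)
    (r : X → ℝ) (hr : IsProb r)
    (hWr : ∀ i, (W.mulVec r) i ≠ 0 → 0 < r i)
    (hmin : ∀ q : X → ℝ, IsProb q → (∀ i, (W.mulVec q) i ≠ 0 → 0 < q i) →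
      clEPrate W G r ≤ clEPrate W G q)
    (p : X → ℝ) (hp : IsProb p)
    (hsupp : ∀ i, 0 < p i → 0 < r i) :
    -∑ i, (W.mulVec (p - r) i * Real.log (r i) + W.mulVec r i * ((p i - r i) / r i))
      + G (p - r) = 0 := by
  have hpr : ∀ i, r i = 0 → p i = 0 := by
    intro i hi
    by_contra h
    exact (hsupp i (lt_of_le_of_ne (hp.1 i) (Ne.symm h))).ne' hi
  let q : ℝ → X → ℝ := fun e => r + e • (p - r)
  have hqi : ∀ e i, q e i = r i + e * (p i - r i) := fun e i => by simp [q]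
  have hq0 : q 0 = r := by simp [q]
  have hqz : ∀ e i, r i = 0 → q e i = 0 := fun e i hi => by
    rw [hqi, hi, hpr i hi]; ring
  have hWq : ∀ e i, W.mulVec (q e) i = W.mulVec r i + e * W.mulVec (p - r) i := fun e i => by
    simp [q, Matrix.mulVec_add, Matrix.mulVec_smul]
  let f : ℝ → ℝ := fun e => -∑ i, W.mulVec (q e) i * Real.log (q e i) + G (q e)
  have hdq : ∀ i, HasDerivAt (fun e => q e i) (p i - r i) 0 := fun i => by
    simp only [hqi]
    simpa using ((hasDerivAt_id (0:ℝ)).mul_const (p i - r i)).const_add (r i)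
  have hdW : ∀ i, HasDerivAt (fun e => W.mulVec (q e) i) (W.mulVec (p - r) i) 0 := fun i => by
    simp only [hWq]
    simpa using ((hasDerivAt_id (0:ℝ)).mul_const (W.mulVec (p - r) i)).const_add (W.mulVec r i)
  have hdG : HasDerivAt (fun e => G (q e)) (G (p - r)) 0 := by
    have : (fun e => G (q e)) = fun e => G r + e * G (p - r) := by
      funext e; simp only [q, map_add, map_smul, smul_eq_mul]
    rw [this]
    simpa using ((hasDerivAt_id (0:ℝ)).mul_const (G (p - r))).const_add (G r)
  have hf : HasDerivAt f (-∑ i, (W.mulVec (p - r) i * Real.log (r i)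
      + W.mulVec r i * ((p i - r i) / r i)) + G (p - r)) 0 := by
    refine HasDerivAt.add (HasDerivAt.neg (HasDerivAt.fun_sum ?_)) hdG
    intro i _
    by_cases hi : r i = 0
    · simp only [hqz _ i hi, hi]
      simpa using hasDerivAt_const (0:ℝ) (0:ℝ)
    · have h2 := (hdW i).mul ((hdq i).log (by rw [hq0]; exact hi))
      simp only [hq0] at h2
      exact h2
  have hpos : ∀ᶠ e in nhds (0:ℝ), ∀ i, r i ≠ 0 → 0 < q e i := by
    rw [Filter.eventually_all]
    intro i
    by_cases hi : r i = 0
    · simp [hi]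
    · have hr0 : 0 < q 0 i := by rw [hq0]; exact lt_of_le_of_ne (hr.1 i) (Ne.symm hi)
      filter_upwards [(hdq i).continuousAt.eventually (lt_mem_nhds hr0)] with e he _ using he
  have hloc : IsLocalMin f 0 := by
    filter_upwards [hpos] with e he
    have hqn : ∀ i, 0 ≤ q e i := fun i => by
      by_cases hi : r i = 0
      · rw [hqz e i hi]
      · exact (he i hi).le
    have hqW : ∀ i, (W.mulVec (q e)) i ≠ 0 → 0 < q e i := fun i h => by
      apply he i
      intro hi
      exact h (aux_pres W hWoff r hr.1 hWr _ (hqz e) i hi)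
    have hqs : ∑ i, q e i = 1 := by
      simp only [hqi, Finset.sum_add_distrib, ← Finset.mul_sum, Finset.sum_sub_distrib,
        hr.2, hp.2]
      ring
    have := hmin (q e) ⟨hqn, hqs⟩ hqW
    rw [aux_rate W hWoff hWcol G r hr.1 hWr, aux_rate W hWoff hWcol G _ hqn hqW] at this
    simp only [f, hq0]
    exact this
  exact hloc.hasDerivAt_eq_zero hf

/-- Instantaneous mismatch cost for classical master-equation dynamics: if `r` minimizes the EP
rate among distributions where it is well defined, then for any distribution `p` with
`supp p ⊆ supp r` and `supp(Wp) ⊆ supp p`, the EP rates are well defined and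
`Σ̇(p) − Σ̇(r) = −(d/dt)|_{t=0⁺} D(exp(tW)p ‖ exp(tW)r)`, the KL divergence being finite for
small `t ≥ 0` since `supp(exp(tW)p) ⊆ supp(exp(tW)r)`. -/
theorem classical_EP_rate_mismatch_cost [Fintype X] [DecidableEq X]
    (W : Matrix X X ℝ)
    (hWoff : ∀ i j : X, j ≠ i → 0 ≤ W j i)
    (hWcol : ∀ i : X, ∑ j, W j i = 0)
    (G : (X → ℝ) →ₗ[ℝ] ℝ)
    (r : X → ℝ) (hr : IsProb r)
    (hWr : ∀ i, (W.mulVec r) i ≠ 0 → 0 < r i)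
    (hmin : ∀ q : X → ℝ, IsProb q → (∀ i, (W.mulVec q) i ≠ 0 → 0 < q i) →
      clEPrate W G r ≤ clEPrate W G q)
    (p : X → ℝ) (hp : IsProb p)
    (hsupp : ∀ i, 0 < p i → 0 < r i)
    (hWp : ∀ i, (W.mulVec p) i ≠ 0 → 0 < p i) :
    DifferentiableWithinAt ℝ
      (fun t : ℝ => shEnt ((NormedSpace.exp (t • W)).mulVec p)) (Set.Ici 0) 0 ∧
    DifferentiableWithinAt ℝ
      (fun t : ℝ => shEnt ((NormedSpace.exp (t • W)).mulVec r)) (Set.Ici 0) 0 ∧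
    (∃ ε : ℝ, 0 < ε ∧ ∀ t ∈ Set.Ico (0 : ℝ) ε, ∀ i,
      0 < (NormedSpace.exp (t • W)).mulVec p i → 0 < (NormedSpace.exp (t • W)).mulVec r i) ∧
    HasDerivWithinAt
      (fun t : ℝ => KL ((NormedSpace.exp (t • W)).mulVec p)
        ((NormedSpace.exp (t • W)).mulVec r))
      (-(clEPrate W G p - clEPrate W G r)) (Set.Ici 0) 0 := by
  have hE := aux_ent W hWoff hWcol p hp.1 hWp
  have hEr := aux_ent W hWoff hWcol r hr.1 hWr
  refine ⟨hE.hasDerivWithinAt.differentiableWithinAt,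
    hEr.hasDerivWithinAt.differentiableWithinAt, ?_, ?_⟩
  · have hpos : ∀ᶠ t in nhds (0:ℝ), ∀ i, 0 < r i →
        0 < (NormedSpace.exp (t • W)).mulVec r i := by
      rw [Filter.eventually_all]
      intro i
      by_cases hi : 0 < r i
      · have h0 : 0 < (NormedSpace.exp ((0:ℝ) • W)).mulVec r i := by
          rw [aux_at_zero]; exact hi
        filter_upwards [(aux_exp_deriv W r i).continuousAt.eventually (lt_mem_nhds h0)]
          with e he _ using he
      · simp [hi]
    obtain ⟨ε, hε, hb⟩ := Metric.eventually_nhds_iff.mp hpos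
    refine ⟨ε, hε, fun t ht i hi => hb ?_ i ?_⟩
    · rw [Real.dist_eq, sub_zero, abs_of_nonneg ht.1]; exact ht.2
    · apply hsupp
      refine lt_of_le_of_ne (hp.1 i) fun h => ?_
      exact hi.ne' (aux_inv W hWoff p hp.1 hWp t i h.symm)
  · refine ((aux_KL W hWoff hWcol p r hp.1 hWp hsupp).congr_deriv ?_).hasDerivWithinAt
    have hs := aux_stat W hWoff hWcol G r hr hWr hmin p hp hsupp
    rw [aux_rate W hWoff hWcol G p hp.1 hWp, aux_rate W hWoff hWcol G r hr.1 hWr]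
    have hterm : ∀ i, W.mulVec (p - r) i * Real.log (r i) + W.mulVec r i * ((p i - r i) / r i)
        = W.mulVec p i * Real.log (r i) - W.mulVec r i * Real.log (r i)
          + p i * (W.mulVec r i / r i) - W.mulVec r i := by
      intro i
      rw [Matrix.mulVec_sub, Pi.sub_apply]
      by_cases hi : r i = 0
      · have h0 := aux_pres W hWoff r hr.1 hWr r (fun _ h => h) i hi
        simp [hi, h0]
      · field_simp
        ring
    simp only [hterm, Finset.sum_add_distrib, Finset.sum_sub_distrib, map_sub,
      aux_colsum W hWcol r] at hs
    simp only [Finset.sum_sub_distrib]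
    linarith
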